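/- Let 𝔐 be a computable graph machine with underlying vertex set G and alphabet 𝔄, and suppose that {𝔐} : 𝔄^{<G} → 𝔄^{G} is a total function. Then {𝔐} is computable from 𝟎^(ω). -/

import Mathlib

open scoped Classical
noncomputable section

/-! ### Oracle computability, Turing reducibility, and the Turing jump -/

/-- Codes for partial functions computable relative to an oracle `O : ℕ → ℕ`. -/
inductive OCode : Type
  | zero | succ | left | right | oracle
  | pair (a b : OCode)
  | comp (a b : OCode)
  | prec (a b : OCode)
  | rfind' (a : OCode)

/-- Evaluation of an oracle code relative to the oracle `O`. -/
def OCode.eval (O : ℕ → ℕ) : OCode → ℕ →. ℕ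
  | .zero => pure 0
  | .succ => fun n => Part.some (n + 1)
  | .left => fun n => Part.some (Nat.unpair n).1
  | .right => fun n => Part.some (Nat.unpair n).2
  | .oracle => fun n => Part.some (O n)
  | .pair cf cg => fun n => Nat.pair <$> OCode.eval O cf n <*> OCode.eval O cg n
  | .comp cf cg => fun n => OCode.eval O cg n >>= OCode.eval O cf
  | .prec cf cg =>
      Nat.unpaired fun a n =>
        n.rec (OCode.eval O cf a) fun y IH => do
          let i ← IH
          OCode.eval O cg (Nat.pair a (Nat.pair y i))
  | .rfind' cf =>
      Nat.unpaired fun a m =>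
        (Nat.rfind fun n => (fun x => x = 0) <$> OCode.eval O cf (Nat.pair a (n + m))).map (· + m)

/-- A standard surjective decoding of natural numbers as oracle codes. -/
def OCode.ofNat : ℕ → OCode
  | 0 => .zero
  | 1 => .succ
  | 2 => .left
  | 3 => .right
  | 4 => .oracle
  | (n + 5) =>
    have h1 : (n / 4).unpair.1 < n + 5 :=
      Nat.lt_succ_of_le (le_trans (Nat.unpair_left_le _)
        (le_trans (Nat.div_le_self n 4) (Nat.le_add_right n 4)))
    have h2 : (n / 4).unpair.2 < n + 5 :=
      Nat.lt_succ_of_le (le_trans (Nat.unpair_right_le _)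
        (le_trans (Nat.div_le_self n 4) (Nat.le_add_right n 4)))
    match n % 4 with
    | 0 => .pair (OCode.ofNat (n / 4).unpair.1) (OCode.ofNat (n / 4).unpair.2)
    | 1 => .comp (OCode.ofNat (n / 4).unpair.1) (OCode.ofNat (n / 4).unpair.2)
    | 2 => .prec (OCode.ofNat (n / 4).unpair.1) (OCode.ofNat (n / 4).unpair.2)
    | _ => .rfind' (OCode.ofNat (n / 4).unpair.1)

/-- `f` is Turing reducible to the oracle `g` (for total functions on `ℕ`). -/
def TuringLE (f g : ℕ → ℕ) : Prop :=
  ∃ c : OCode, ∀ n, c.eval g n = Part.some (f n)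

/-- Turing equivalence of total functions on `ℕ`. -/
def TuringEq (f g : ℕ → ℕ) : Prop := TuringLE f g ∧ TuringLE g f

/-- The Turing jump of an oracle. -/
def tjump (O : ℕ → ℕ) : ℕ → ℕ :=
  fun e => if ((OCode.ofNat e).eval O e).Dom then 1 else 0

/-- The `n`-th iterate of the Turing jump. -/
def tjumpIter (O : ℕ → ℕ) : ℕ → ℕ → ℕ
  | 0 => O
  | n + 1 => tjump (tjumpIter O n)

/-- `𝟎^(n)`, the `n`-th jump of the computable degree. -/
def zeroN (n : ℕ) : ℕ → ℕ := tjumpIter (fun _ => 0) n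

/-- `𝟎'`, the degree of the halting problem. -/
def zeroJump : ℕ → ℕ := zeroN 1

/-- The effective join `⨁ₙ F^(n)`. -/
def omegaIter (F : ℕ → ℕ) : ℕ → ℕ := fun p => tjumpIter F p.unpair.1 p.unpair.2

/-- `𝟎^(ω)`, the effective join of all `𝟎^(n)`. -/
def zeroOmega : ℕ → ℕ := omegaIter (fun _ => 0)

/-- The effective join of two oracles. -/
def oJoin (F G : ℕ → ℕ) : ℕ → ℕ :=
  fun k => if k % 2 = 0 then F (k / 2) else G (k / 2)

/-- The characteristic function of a set of naturals. -/
def charFun (X : Set ℕ) : ℕ → ℕ := fun k => if k ∈ X then 1 else 0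

/-- Kleene bracket: the `e`-th computable partial function. -/
def phi (e : ℕ) : ℕ →. ℕ := (Denumerable.ofNat Nat.Partrec.Code e).eval

/-! ### Colored graphs -/

/-- A colored graph with vertices, labels and colors drawn from `ℕ`.
`E v w` is the (finite) set of colors of edges from `v` to `w`, and `gam` is the
allowable colors function. -/
structure ColoredGraph where
  G : Set ℕ
  L : Set ℕ
  C : Set ℕ
  V : ℕ → ℕ
  E : ℕ → ℕ → Finset ℕ
  gam : ℕ → Finset ℕ
  V_mem : ∀ v ∈ G, V v ∈ L
  E_sub : ∀ v w : ℕ, (E v w : Set ℕ) ⊆ C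
  gam_sub : ∀ l ∈ L, (gam l : Set ℕ) ⊆ C
  E_allowed : ∀ v ∈ G, ∀ w ∈ G, E v w ⊆ gam (V v) ∩ gam (V w)

/-- A computable colored graph. -/
def ColoredGraph.Computable' (g : ColoredGraph) : Prop :=
  ComputablePred (· ∈ g.G) ∧ ComputablePred (· ∈ g.L) ∧ ComputablePred (· ∈ g.C) ∧
    Computable g.V ∧
    Computable (fun p : ℕ × ℕ => Encodable.encode (g.E p.1 p.2)) ∧
    Computable (fun l => Encodable.encode (g.gam l))

/-- A colored graph is finitary if its set of labels is finite. -/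
def ColoredGraph.Finitary (g : ColoredGraph) : Prop := g.L.Finite

/-- The set of vertices incident to `v`. -/
def ColoredGraph.degSet (g : ColoredGraph) (v : ℕ) : Set ℕ :=
  {w ∈ g.G | g.E v w ≠ ∅ ∨ g.E w v ≠ ∅}

/-- `g` has finite degree if every vertex has finitely many neighbours. -/
def ColoredGraph.FiniteDegree (g : ColoredGraph) : Prop :=
  ∀ v ∈ g.G, (g.degSet v).Finite

/-- The degree function of `g` (as a total function on `ℕ`). -/
def ColoredGraph.degFun (g : ColoredGraph) : ℕ → ℕ :=
  fun v => if v ∈ g.G then (g.degSet v).ncard else 0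

/-- `g` has constant (finite) degree. -/
def ColoredGraph.ConstantDegree (g : ColoredGraph) : Prop :=
  ∃ d : ℕ, ∀ v ∈ g.G, (g.degSet v).Finite ∧ (g.degSet v).ncard = d

/-- Adjacency in the underlying graph. -/
def ColoredGraph.Adj (g : ColoredGraph) (v w : ℕ) : Prop :=
  v ∈ g.G ∧ w ∈ g.G ∧ (g.E v w ≠ ∅ ∨ g.E w v ≠ ∅)

/-- `A` is a connected subset (the vertex set of a connected subgraph) of `g`. -/
def ColoredGraph.ConnectedSubset (g : ColoredGraph) (A : Set ℕ) : Prop :=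
  A ⊆ g.G ∧ ∀ v ∈ A, ∀ w ∈ A,
    Relation.ReflTransGen (fun a b => g.Adj a b ∧ a ∈ A ∧ b ∈ A) v w

/-- The 1-neighborhood of a set of vertices. -/
def ColoredGraph.nbhd (g : ColoredGraph) (A : Set ℕ) : Set ℕ :=
  A ∪ {v ∈ g.G | ∃ a ∈ A, g.E v a ≠ ∅ ∨ g.E a v ≠ ∅}

/-- Restriction of a colored graph to the induced subgraph on `B`. -/
def ColoredGraph.restrict (g : ColoredGraph) (B : Set ℕ) : ColoredGraph :=
  { g with
    G := g.G ∩ B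
    V_mem := fun v hv => g.V_mem v hv.1
    E_allowed := fun v hv w hw => g.E_allowed v hv.1 w hw.1 }

/-! ### Graph Turing machines -/

/-- A configuration assigns to each vertex a finite set of (received) colored pulses,
a displayed alphabet symbol, and a state. -/
abbrev Config := ℕ → Finset ℕ × ℕ × ℕ

/-- A graph Turing machine. -/
structure GraphMachine where
  graph : ColoredGraph
  A : Finset ℕ
  zero_mem : 0 ∈ A
  one_mem : 1 ∈ A
  S : Set ℕ
  s : ℕ
  alpha : ℕ → Finset ℕ
  T : ℕ → Finset ℕ → ℕ → ℕ → Finset ℕ × ℕ × ℕ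
  alpha_sub : ∀ l ∈ graph.L, (alpha l : Set ℕ) ⊆ S
  s_mem : ∀ l ∈ graph.L, s ∈ alpha l
  T_trivial : ∀ l c z t, (¬ c ⊆ graph.gam l ∨ t ∉ alpha l) → T l c z t = (c, z, t)
  T_compat : ∀ l c z t, t ∈ alpha l → c ⊆ graph.gam l → z ∈ A →
    (T l c z t).1 ⊆ graph.gam l ∧ (T l c z t).2.1 ∈ A ∧ (T l c z t).2.2 ∈ alpha l
  T_init : ∀ l, T l ∅ 0 s = (∅, 0, s)

/-- A computable graph machine. -/
def GraphMachine.Computable' (M : GraphMachine) : Prop :=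
  M.graph.Computable' ∧ ComputablePred (· ∈ M.S) ∧
    Computable (fun l => Encodable.encode (M.alpha l)) ∧
    Computable (fun q : ℕ × ℕ × ℕ × ℕ =>
      Encodable.encode
        (M.T q.1 ((Encodable.decode (α := Finset ℕ) q.2.1).getD ∅) q.2.2.1 q.2.2.2))

/-- A valid configuration for `M`. -/
def GraphMachine.Valid (M : GraphMachine) (f : Config) : Prop :=
  ∀ v ∈ M.graph.G, (f v).1 ⊆ M.graph.gam (M.graph.V v) ∧
    (f v).2.2 ∈ M.alpha (M.graph.V v)

/-- The set of colored pulses received by `v` in one step from configuration `g`: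
`⋃ w ∈ G, E w v ∩ (g w).1`. -/
def GraphMachine.pulses (M : GraphMachine) (g : Config) (v : ℕ) : Finset ℕ :=
  (M.graph.gam (M.graph.V v)).filter
    (fun c => ∃ w ∈ M.graph.G, c ∈ M.graph.E w v ∧ c ∈ (g w).1)

/-- One step of the machine. -/
def GraphMachine.step (M : GraphMachine) (g : Config) : Config :=
  fun v => M.T (M.graph.V v) (M.pulses g v) (g v).2.1 (g v).2.2

/-- The run of `M` on configuration `f`: `M.run f n v = ⟨M,f⟩(v,n)`. -/
def GraphMachine.run (M : GraphMachine) (f : Config) : ℕ → Config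
  | 0 => f
  | n + 1 => M.step (M.run f n)

/-- Restriction of a graph machine to the induced subgraph on `B`. -/
def GraphMachine.restrict (M : GraphMachine) (B : Set ℕ) : GraphMachine :=
  { M with graph := M.graph.restrict B }

/-- The restriction `f|_B` of a configuration (trivial data outside `B`). -/
def restrictConfig (M : GraphMachine) (f : Config) (B : Set ℕ) : Config :=
  fun v => if v ∈ B then f v else (∅, 0, M.s)

/-- The run of `M` on `f` halts at stage `n`. -/
def GraphMachine.HaltsAt (M : GraphMachine) (f : Config) (n : ℕ) : Prop :=
  ∀ v ∈ M.graph.G, M.run f (n + 1) v = M.run f n v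

/-- The run of `M` on `f` halts. -/
def GraphMachine.Halts (M : GraphMachine) (f : Config) : Prop :=
  ∃ n, M.HaltsAt f n

/-- The starting configuration determined by a display function `x`. -/
def GraphMachine.start (M : GraphMachine) (x : ℕ → ℕ) : Config :=
  fun v => (∅, x v, M.s)

/-- `x ∈ 𝔄^{<G}`: alphabet values on `G`, zero off `G`, finite support. -/
def GraphMachine.InDom (M : GraphMachine) (x : ℕ → ℕ) : Prop :=
  (∀ v ∈ M.graph.G, x v ∈ M.A) ∧ (∀ v ∉ M.graph.G, x v = 0) ∧ {v | x v ≠ 0}.Finite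

/-- The displayed symbols at the (first) halting stage of the run on `x̂`. -/
def GraphMachine.outputAt (M : GraphMachine) (x : ℕ → ℕ) : ℕ → ℕ :=
  fun v => (M.run (M.start x) (sInf {n | M.HaltsAt (M.start x) n}) v).2.1

/-- `{M}` is total. -/
def GraphMachine.Total (M : GraphMachine) : Prop :=
  ∀ x, M.InDom x → M.Halts (M.start x)

/-- Decoding a natural number as a finitely supported function `ℕ → ℕ`. -/
def decodeFS (n : ℕ) : ℕ → ℕ := fun v => (Denumerable.ofNat (List ℕ) n).getD v 0

/-- The function `{M}` as a total function on `ℕ` (input: code of a finitely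
supported display function paired with a vertex of `G`). -/
def GraphMachine.fn (M : GraphMachine) : ℕ → ℕ := fun p =>
  if M.InDom (decodeFS p.unpair.1) ∧ M.Halts (M.start (decodeFS p.unpair.1)) ∧
      p.unpair.2 ∈ M.graph.G then
    M.outputAt (decodeFS p.unpair.1) p.unpair.2
  else 0

/-- The restriction `x|_X` (zero outside `X`). -/
def restrictTo (X : Set ℕ) (x : ℕ → ℕ) : ℕ → ℕ :=
  fun v => if v ∈ X then x v else 0

/-- `ζ : 𝔄^{<X} → 𝔄^X` is `⟨𝒢,X⟩`-computable via `M`. -/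
def GraphMachine.ComputesVia (M : GraphMachine) (X : Set ℕ) (ζ : (ℕ → ℕ) → ℕ → ℕ) :
    Prop :=
  (∀ x, M.InDom x → M.Halts (M.start x)) ∧
  (∀ x y, M.InDom x → M.InDom y → restrictTo X x = restrictTo X y →
      ∀ v ∈ M.graph.G, M.outputAt x v = M.outputAt y v) ∧
  (∀ x, M.InDom x → ∀ v ∈ M.graph.G, v ∉ X → M.outputAt x v = 0) ∧
  (∀ x, M.InDom x → ∀ v ∈ X, M.outputAt x v = ζ (restrictTo X x) v)

/-- `ζ` is `⟨𝒢,X⟩`-computable via the computable machine `M`, where `X` is an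
infinite computable subset of `G`. -/
def GraphComputableVia (M : GraphMachine) (X : Set ℕ) (ζ : (ℕ → ℕ) → ℕ → ℕ) : Prop :=
  M.Computable' ∧ X.Infinite ∧ ComputablePred (· ∈ X) ∧ X ⊆ M.graph.G ∧
    M.ComputesVia X ζ

/-- `ζ` as a total function on `ℕ`. -/
def zetaFn (M : GraphMachine) (X : Set ℕ) (ζ : (ℕ → ℕ) → ℕ → ℕ) : ℕ → ℕ := fun p =>
  if (∀ v ∈ X, decodeFS p.unpair.1 v ∈ M.A) ∧ (∀ v ∉ X, decodeFS p.unpair.1 v = 0) ∧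
      p.unpair.2 ∈ X then
    ζ (decodeFS p.unpair.1) p.unpair.2
  else 0

/-- A configuration as a total function on `ℕ` (to serve as a Turing oracle). -/
def configFn (f : Config) : ℕ → ℕ := fun v => Encodable.encode (f v)

/-- The run of `M` on `f` as a total function on `ℕ`. -/
def runFn (M : GraphMachine) (f : Config) : ℕ → ℕ := fun p =>
  if p.unpair.1 ∈ M.graph.G then Encodable.encode (M.run f p.unpair.2 p.unpair.1) else 0

/-- A function `Finset ℕ → Finset ℕ` as a total function on `ℕ`. -/
def finsetFn (Θ : Finset ℕ → Finset ℕ) : ℕ → ℕ := fun k =>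
  Encodable.encode (Θ ((Encodable.decode (α := Finset ℕ) k).getD ∅))

/-- `(B i)_{i ≤ n}` is an `n`-approximation of `M` and `f` on `A`. -/
def IsApprox (M : GraphMachine) (f : Config) (n : ℕ) (B : ℕ → Set ℕ) (A : Set ℕ) :
    Prop :=
  B 0 = A ∧ (∀ i ≤ n, B i ⊆ M.graph.G) ∧ (∀ i < n, B i ⊆ B (i + 1)) ∧
  ∀ i < n, ∀ B' : Set ℕ, B (i + 1) ⊆ B' → B' ⊆ M.graph.G →
    ∀ v ∈ B (i + 1),
      (M.restrict (B (i + 1))).run (restrictConfig M (M.run f i) (B (i + 1))) 1 v =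
        (M.restrict B').run (restrictConfig M (M.run f i) B') 1 v

/-- The characteristic function of the collection `P n f` of `n`-approximations,
as a function on (codes of) pairs `(A, (B i)_{i ≤ n})` of finite sets. -/
def approxChar (M : GraphMachine) (f : Config) (n : ℕ) : ℕ → ℕ := fun k =>
  match Encodable.decode (α := Finset ℕ × List (Finset ℕ)) k with
  | some p =>
      if p.2.length = n + 1 ∧ ↑p.1 ⊆ M.graph.G ∧
          IsApprox M f n (fun i => ↑(p.2.getD i ∅)) ↑p.1 then 1 else 0
  | none => 0

/-- `Θ` is a uniform approximation of `M`. -/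
def UniformApprox (M : GraphMachine) (Θ : Finset ℕ → Finset ℕ) : Prop :=
  ∀ A : Finset ℕ, ↑A ⊆ M.graph.G →
    A ⊆ Θ A ∧ ↑(Θ A) ⊆ M.graph.G ∧
      ∀ f : Config, M.Valid f →
        IsApprox M f 1 (fun i => if i = 0 then (↑A : Set ℕ) else ↑(Θ A)) ↑A

/-- `M` halts within `c` steps on every starting configuration supported on a
finite connected subgraph. -/
def GraphMachine.HaltsWithin (M : GraphMachine) (c : ℕ) : Prop :=
  ∀ A : Set ℕ, A.Finite → M.graph.ConnectedSubset A →
    ∀ x : ℕ → ℕ, M.InDom x → (∀ v ∉ A, x v = 0) → M.HaltsAt (M.start x) c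

/-- `M` runs in linear space. -/
def GraphMachine.RunsInLinearSpace (M : GraphMachine) : Prop :=
  M.Total ∧ ∃ a b c d : ℕ,
    ∀ A : Set ℕ, A.Finite → M.graph.ConnectedSubset A →
      ∀ x : ℕ → ℕ, M.InDom x → (∀ v ∉ A, x v = 0) →
        (M.graph.nbhd^[a * A.ncard + b] A).encard ≤ (c * A.ncard + d : ℕ) ∧
        ∀ v ∈ A, ∀ n : ℕ,
          M.run (M.start x) n v =
            (M.restrict (M.graph.nbhd^[a * A.ncard + b] A)).run
              (restrictConfig M (M.start x) (M.graph.nbhd^[a * A.ncard + b] A)) n v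

/-! ### Iterated limits -/

/-- `lim_{k→∞} u k = a` for `ℕ`-valued sequences (eventual constancy). -/
def EvLim (u : ℕ → ℕ) (a : ℕ) : Prop := ∃ N, ∀ k ≥ N, u k = a

/-- `IterLim n F a`: the `n`-fold iterated limit
`lim_{x₀→∞} ⋯ lim_{x_{n-1}→∞} F (x₀, …, x_{n-1})` exists and equals `a`. -/
def IterLim : (n : ℕ) → ((Fin n → ℕ) → ℕ) → ℕ → Prop
  | 0, F, a => F (fun i => i.elim0) = a
  | n + 1, F, a =>
      ∃ u : ℕ → ℕ, (∀ x, IterLim n (fun xs => F (Fin.cons x xs)) (u x)) ∧ EvLim u a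

/-- `X` is `k`-computably enumerable (as a `{0,1}`-valued function `X : ℕ → ℕ`). -/
def KCE (X : ℕ → ℕ) (k : ℕ) : Prop :=
  ∃ g : ℕ → ℕ → ℕ, Computable₂ g ∧ (∀ n m, g n m ≤ 1) ∧ (∀ m, g 0 m = 0) ∧
    (∀ m, ∃ N, ∀ n ≥ N, g n m = X m) ∧
    (∀ m, {l : ℕ | g l m ≠ g (l + 1) m}.encard ≤ (k : ℕ∞))


/-! ### Oracle codes: uniform closure properties -/

/-- A functional computed uniformly by one oracle code. -/
def UnifC (F : (ℕ → ℕ) → ℕ → ℕ) : Prop :=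
  ∃ c : OCode, ∀ O n, c.eval O n = Part.some (F O n)

/-- Translation of ordinary codes to oracle codes. -/
def toOCode : Nat.Partrec.Code → OCode
  | .zero => .zero
  | .succ => .succ
  | .left => .left
  | .right => .right
  | .pair a b => .pair (toOCode a) (toOCode b)
  | .comp a b => .comp (toOCode a) (toOCode b)
  | .prec a b => .prec (toOCode a) (toOCode b)
  | .rfind' a => .rfind' (toOCode a)

theorem toOCode_eval (O : ℕ → ℕ) (c : Nat.Partrec.Code) :
    (toOCode c).eval O = c.eval := by
  induction c with
  | zero => rfl
  | succ => rfl
  | left => rfl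
  | right => rfl
  | pair a b iha ihb =>
    simp only [toOCode, OCode.eval, Nat.Partrec.Code.eval, iha, ihb]
    rfl
  | comp a b iha ihb =>
    simp only [toOCode, OCode.eval, Nat.Partrec.Code.eval, iha, ihb]
    rfl
  | prec a b iha ihb =>
    simp only [toOCode, OCode.eval, Nat.Partrec.Code.eval, iha, ihb]
    rfl
  | rfind' a iha =>
    simp only [toOCode, OCode.eval, Nat.Partrec.Code.eval, iha]
    congr! 7

theorem UnifC.of_computable {f : ℕ → ℕ} (hf : Computable f) : UnifC fun _ => f := by
  have h : Nat.Partrec (f : ℕ →. ℕ) := Partrec.nat_iff.1 hf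
  obtain ⟨c, hc⟩ := Nat.Partrec.Code.exists_code.1 h
  exact ⟨toOCode c, fun O n => by rw [toOCode_eval, hc]; rfl⟩

theorem UnifC.oracle : UnifC fun O => O := ⟨.oracle, fun _ _ => rfl⟩

theorem UnifC.comp {F H : (ℕ → ℕ) → ℕ → ℕ} (hF : UnifC F) (hH : UnifC H) :
    UnifC fun O n => F O (H O n) := by
  obtain ⟨c, hc⟩ := hF
  obtain ⟨d, hd⟩ := hH
  exact ⟨.comp c d, fun O n => by
    simp only [OCode.eval, hd]; exact (Part.bind_some _ _).trans (hc _ _)⟩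

theorem UnifC.pair {F H : (ℕ → ℕ) → ℕ → ℕ} (hF : UnifC F) (hH : UnifC H) :
    UnifC fun O n => Nat.pair (F O n) (H O n) := by
  obtain ⟨c, hc⟩ := hF
  obtain ⟨d, hd⟩ := hH
  exact ⟨.pair c d, fun O n => by simp [OCode.eval, hc, hd, Seq.seq]⟩

theorem rfind_dom_iff (f : ℕ → ℕ) :
    (Nat.rfind (fun w => Part.some (decide (f w = 0)) : ℕ →. Bool)).Dom ↔ ∃ w, f w = 0 := by
  refine Nat.rfind_dom'.trans (exists_congr fun w => ?_)
  constructor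
  · intro h
    have h1 := Part.mem_some_iff.1 h.1
    simpa using h1.symm
  · intro h
    exact ⟨Part.mem_some_iff.2 (by simp [h]), fun _ => trivial⟩

theorem UnifC.search {F : (ℕ → ℕ) → ℕ → ℕ} (hF : UnifC F) :
    ∃ c : OCode, ∀ O n, ((c.eval O n).Dom ↔ ∃ w, F O (Nat.pair n w) = 0) ∧
      ∀ w ∈ c.eval O n, F O (Nat.pair n w) = 0 := by
  obtain ⟨c, hc⟩ := hF
  have hid : UnifC fun _ n => Nat.pair n 0 :=
    .of_computable (Primrec₂.natPair.comp Primrec.id (Primrec.const 0)).to_comp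
  obtain ⟨d, hd⟩ := hid
  have key : ∀ O n, (OCode.comp (.rfind' c) d).eval O n =
      Nat.rfind (fun w => Part.some (decide (F O (Nat.pair n w) = 0)) : ℕ →. Bool) := by
    intro O n
    simp [OCode.eval, hc, hd]
    exact Part.map_id' (fun _ => rfl) _
  refine ⟨.comp (.rfind' c) d, fun O n => ?_⟩
  rw [key]
  refine ⟨rfind_dom_iff fun w => F O (Nat.pair n w), fun w hw => ?_⟩
  have := Part.mem_some_iff.1 (Nat.rfind_spec hw)
  simpa using this.symm

/-! ### Numbering of codes -/

theorem ofNat_surj (c : OCode) : ∃ e, OCode.ofNat e = c := by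
  have key : ∀ a b i, i < 4 → (4 * Nat.pair a b + i) / 4 = Nat.pair a b ∧
      (4 * Nat.pair a b + i) % 4 = i := by intros; omega
  induction c with
  | zero => exact ⟨0, by simp [OCode.ofNat]⟩
  | succ => exact ⟨1, by simp [OCode.ofNat]⟩
  | left => exact ⟨2, by simp [OCode.ofNat]⟩
  | right => exact ⟨3, by simp [OCode.ofNat]⟩
  | oracle => exact ⟨4, by simp [OCode.ofNat]⟩
  | pair a b iha ihb =>
    obtain ⟨i, rfl⟩ := iha
    obtain ⟨j, rfl⟩ := ihb
    exact ⟨4 * Nat.pair i j + 5, by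
      have h1 : (4 * Nat.pair i j) / 4 = Nat.pair i j := by omega
      have h2 : (4 * Nat.pair i j) % 4 = 0 := by omega
      rw [OCode.ofNat]; simp only [h1, h2, Nat.unpair_pair]⟩
  | comp a b iha ihb =>
    obtain ⟨i, rfl⟩ := iha
    obtain ⟨j, rfl⟩ := ihb
    exact ⟨4 * Nat.pair i j + 1 + 5, by
      rw [OCode.ofNat]; simp only [key i j 1 (by omega), Nat.unpair_pair]⟩
  | prec a b iha ihb =>
    obtain ⟨i, rfl⟩ := iha
    obtain ⟨j, rfl⟩ := ihb
    exact ⟨4 * Nat.pair i j + 2 + 5, by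
      rw [OCode.ofNat]; simp only [key i j 2 (by omega), Nat.unpair_pair]⟩
  | rfind' a iha =>
    obtain ⟨i, rfl⟩ := iha
    exact ⟨4 * Nat.pair i 0 + 3 + 5, by
      rw [OCode.ofNat]; simp only [key i 0 3 (by omega), Nat.unpair_pair]⟩

/-- Index of the composition of two codes. -/
def compIdx (a b : ℕ) : ℕ := 4 * Nat.pair a b + 1 + 5

theorem ofNat_compIdx (a b : ℕ) :
    OCode.ofNat (compIdx a b) = .comp (OCode.ofNat a) (OCode.ofNat b) := by
  have h1 : (4 * Nat.pair a b + 1) / 4 = Nat.pair a b := by omega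
  have h2 : (4 * Nat.pair a b + 1) % 4 = 1 := by omega
  rw [compIdx, OCode.ofNat]; simp only [h1, h2, Nat.unpair_pair]

/-- Index of a code for the constant function `n`. -/
def constIdx (n : ℕ) : ℕ := Nat.rec 0 (fun _ i => compIdx 1 i) n

theorem constIdx_eval (O : ℕ → ℕ) (n k : ℕ) :
    (OCode.ofNat (constIdx n)).eval O k = Part.some n := by
  induction n with
  | zero => simp [constIdx, OCode.ofNat, OCode.eval]; rfl
  | succ n ih =>
    have : constIdx (n + 1) = compIdx 1 (constIdx n) := rfl
    rw [this, ofNat_compIdx]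
    simp [OCode.eval, ih, OCode.ofNat]

theorem compIdx_prim : Primrec₂ compIdx := by
  have : Primrec₂ fun a b : ℕ => 4 * Nat.pair a b + 6 :=
    (Primrec.nat_add.comp (Primrec.nat_mul.comp (Primrec.const 4) Primrec₂.natPair)
      (Primrec.const 6))
  exact this.of_eq fun a b => rfl

theorem constIdx_prim : Primrec constIdx :=
  Primrec.nat_rec₁ 0 (compIdx_prim.comp (Primrec.const 1) Primrec.snd).to₂

/-- Index of `e` applied to the constant `⟨e, ⟨m, k⟩⟩`. -/
def qIdx (e m k : ℕ) : ℕ := compIdx e (constIdx (Nat.pair e (Nat.pair m k)))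

theorem qIdx_eval (O : ℕ → ℕ) (e m k j : ℕ) :
    (OCode.ofNat (qIdx e m k)).eval O j =
      (OCode.ofNat e).eval O (Nat.pair e (Nat.pair m k)) := by
  rw [qIdx, ofNat_compIdx]
  simp only [OCode.eval, constIdx_eval]
  exact Part.bind_some _ _

theorem qIdx_prim : Primrec fun p : ℕ × ℕ × ℕ => qIdx p.1 p.2.1 p.2.2 :=
  compIdx_prim.comp Primrec.fst (constIdx_prim.comp
    (Primrec₂.natPair.comp Primrec.fst (Primrec₂.natPair.comp
      (Primrec.fst.comp Primrec.snd) (Primrec.snd.comp Primrec.snd))))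

/-! ### The hierarchy lemma -/

/-- The hierarchy of predicates generated by a decidable matrix `a`. -/
def hierQ (a : ℕ → ℕ → ℕ → Bool) : ℕ → ℕ → Prop
  | 0, _ => False
  | m + 1, k => ∃ w, a (m + 1) k w = true ∧ ¬ hierQ a m (Nat.pair k.unpair.1 w)

theorem hier_index (a : ℕ → ℕ → ℕ → Bool)
    (ha : Computable fun p : ℕ × ℕ × ℕ => a p.1 p.2.1 p.2.2) :
    ∃ q : ℕ → ℕ → ℕ, Computable₂ q ∧
      ∀ m k, zeroN m (q m k) = if hierQ a m k then 1 else 0 := by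
  -- input of the search matrix: `⟨⟨e, ⟨m, k⟩⟩, w⟩`
  let u : ℕ → ℕ := fun i =>
    qIdx i.unpair.1.unpair.1 (i.unpair.1.unpair.2.unpair.1 - 1)
      (Nat.pair i.unpair.1.unpair.2.unpair.2.unpair.1 i.unpair.2)
  let b : ℕ → Bool := fun i =>
    a i.unpair.1.unpair.2.unpair.1 i.unpair.1.unpair.2.unpair.2 i.unpair.2
  have p1 : Primrec fun i : ℕ => i.unpair.1 := Primrec.fst.comp Primrec.unpair
  have p2 : Primrec fun i : ℕ => i.unpair.2 := Primrec.snd.comp Primrec.unpair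
  have hu : Primrec u :=
    qIdx_prim.comp (Primrec.pair (p1.comp p1) (Primrec.pair
      (Primrec.nat_sub.comp (p1.comp (p2.comp p1)) (Primrec.const 1))
      (Primrec₂.natPair.comp (p1.comp (p2.comp (p2.comp p1))) p2)))
  have hb : Computable b :=
    Computable.comp (f := fun p : ℕ × ℕ × ℕ => a p.1 p.2.1 p.2.2)
      (g := fun i : ℕ => (i.unpair.1.unpair.2.unpair.1, i.unpair.1.unpair.2.unpair.2, i.unpair.2))
      ha (Primrec.pair (p1.comp (p2.comp p1)) (Primrec.pair (p2.comp (p2.comp p1)) p2)).to_comp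
  have hbn : Computable fun i => cond (b i) 0 1 :=
    Computable.cond hb (Computable.const 0) (Computable.const 1)
  have hadd : UnifC fun _ i => i.unpair.1 + i.unpair.2 :=
    .of_computable (Primrec.nat_add.comp p1 p2).to_comp
  have hF : UnifC fun O i => cond (b i) 0 1 + O (u i) := by
    have := hadd.comp ((UnifC.of_computable hbn).pair
      (UnifC.oracle.comp (UnifC.of_computable hu.to_comp)))
    simpa using this
  obtain ⟨c, hc⟩ := hF.search
  obtain ⟨e, he⟩ := ofNat_surj c
  refine ⟨qIdx e, (qIdx_prim.comp (Primrec.pair (Primrec.const e)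
    (Primrec.pair Primrec.fst Primrec.snd))).to_comp, ?_⟩
  intro m
  induction m with
  | zero => intro k; simp [hierQ, zeroN, tjumpIter]
  | succ m ih =>
    intro k
    have : zeroN (m + 1) = tjump (zeroN m) := rfl
    rw [this, tjump, qIdx_eval, he]
    congr 1
    simp only [hierQ, eq_iff_iff]
    refine (hc _ _).1.trans (exists_congr fun w => ?_)
    simp only [u, b, Nat.unpair_pair, Nat.add_sub_cancel, ih]
    cases a (m + 1) k w <;> by_cases h : hierQ a m (Nat.pair k.unpair.1 w) <;> simp [h]

/-! ### Computability on lists -/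

theorem eqb_comp {α : Type*} [Primcodable α] {f g : α → ℕ} (hf : Computable f)
    (hg : Computable g) : Computable fun a => decide (f a = g a) := by
  have h : Primrec fun p : ℕ × ℕ => decide (p.1 = p.2) :=
    primrecPred_iff_primrec_decide.1 (Primrec.eq (α := ℕ))
  exact h.to_comp.comp (hf.pair hg)

theorem ltb_comp {α : Type*} [Primcodable α] {f g : α → ℕ} (hf : Computable f)
    (hg : Computable g) : Computable fun a => decide (f a < g a) := by
  have h : Primrec fun p : ℕ × ℕ => decide (p.1 < p.2) :=
    primrecPred_iff_primrec_decide.1 Primrec.nat_lt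
  exact h.to_comp.comp (hf.pair hg)

theorem and_comp {α : Type*} [Primcodable α] {f g : α → Bool} (hf : Computable f)
    (hg : Computable g) : Computable fun a => f a && g a :=
  (Primrec.and.to_comp).comp hf hg

theorem or_comp {α : Type*} [Primcodable α] {f g : α → Bool} (hf : Computable f)
    (hg : Computable g) : Computable fun a => f a || g a :=
  (Primrec.or.to_comp).comp hf hg

theorem not_comp {α : Type*} [Primcodable α] {f : α → Bool} (hf : Computable f) :
    Computable fun a => !f a :=
  (Primrec.not.to_comp).comp hf

theorem getD_comp {α : Type*} [Primcodable α] {l : α → List ℕ} {f : α → ℕ}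
    (hl : Computable l) (hf : Computable f) : Computable fun a => (l a).getD (f a) 0 :=
  ((Primrec.list_getD 0).to_comp).comp hl hf

theorem filter_comp {α : Type*} [Primcodable α] {l : α → List ℕ} {p : α → ℕ → Bool}
    (hl : Computable l) (hp : Computable₂ p) : Computable fun a => (l a).filter (p a) := by
  have h : Computable₂ fun (a : α) (q : ℕ × List ℕ) =>
      cond (p a ((l a).getD q.1 0)) (q.2 ++ [(l a).getD q.1 0]) q.2 := by
    have hg : Computable fun x : α × (ℕ × List ℕ) => (l x.1).getD x.2.1 0 :=
      getD_comp (hl.comp Computable.fst) (Computable.fst.comp Computable.snd)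
    have h2 : Computable fun x : α × (ℕ × List ℕ) => x.2.2 :=
      Computable.snd.comp Computable.snd
    exact Computable.cond (hp.comp Computable.fst hg) (Computable.list_concat.comp h2 hg) h2
  refine (Computable.nat_rec (Computable.list_length.comp hl) (Computable.const []) h).of_eq ?_
  intro a
  have key : ∀ n, n ≤ (l a).length → (Nat.rec [] (fun y IH =>
      cond (p a ((l a).getD y 0)) (IH ++ [(l a).getD y 0]) IH) n : List ℕ) =
      ((l a).take n).filter (p a) := by
    intro n
    induction n with
    | zero => intro _; simp
    | succ n ih =>
      intro hn
      have hlt : n < (l a).length := hn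
      simp only [ih hlt.le]
      rw [List.take_succ_eq_append_getElem hlt, List.filter_append,
        List.getD_eq_getElem _ _ hlt]
      cases h : p a (l a)[n] <;> simp [h]
  have := key _ le_rfl
  rw [List.take_length] at this
  exact this

theorem any_comp {α : Type*} [Primcodable α] {l : α → List ℕ} {p : α → ℕ → Bool}
    (hl : Computable l) (hp : Computable₂ p) : Computable fun a => (l a).any (p a) := by
  refine (ltb_comp (Computable.const 0)
    (Computable.list_length.comp (filter_comp hl hp))).of_eq ?_
  intro a
  rw [Bool.eq_iff_iff]
  simp [List.length_pos_iff]

theorem mem_comp {α : Type*} [Primcodable α] {f : α → ℕ} {l : α → List ℕ}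
    (hf : Computable f) (hl : Computable l) : Computable fun a => decide (f a ∈ l a) := by
  refine (any_comp (p := fun a c => decide (f a = c)) hl
    (eqb_comp (hf.comp Computable.fst) Computable.snd)).of_eq ?_
  intro a
  rw [Bool.eq_iff_iff]
  simp

/-- Decoding of a list of naturals. -/
def lst (n : ℕ) : List ℕ := Denumerable.ofNat (List ℕ) n

theorem lst_comp {α : Type*} [Primcodable α] {f : α → ℕ} (hf : Computable f) :
    Computable fun a => lst (f a) := (Computable.ofNat (List ℕ)).comp hf

theorem lst_encode (l : List ℕ) : lst (Encodable.encode l) = l := Denumerable.ofNat_encode l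

theorem encode_lst (n : ℕ) : Encodable.encode (lst n) = n := Denumerable.encode_ofNat n

theorem encode_finset (s : Finset ℕ) :
    Encodable.encode s = Encodable.encode (s.1.sort (fun a b : ℕ => a ≤ b)) := by
  rfl

theorem mem_lst_finset (s : Finset ℕ) (c : ℕ) : c ∈ lst (Encodable.encode s) ↔ c ∈ s := by
  rw [encode_finset, lst_encode]; simp

theorem encode_filter (s : Finset ℕ) (p : ℕ → Bool) (t : Finset ℕ)
    (h : ∀ c, c ∈ t ↔ c ∈ s ∧ p c = true) :
    Encodable.encode ((lst (Encodable.encode s)).filter p) = Encodable.encode t := by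
  rw [encode_finset, encode_finset, lst_encode]
  congr 1
  refine List.Perm.eq_of_pairwise (le := fun a b : ℕ => a ≤ b) ?_ ?_ ?_ ?_
  · intro a b _ _ h1 h2; exact le_antisymm h1 h2
  · exact (Multiset.pairwise_sort _ _).filter _
  · exact Multiset.pairwise_sort _ _
  · have hs : (s.1.sort (fun a b : ℕ => a ≤ b)).Nodup := by
      rw [← Multiset.coe_nodup, Multiset.sort_eq]; exact s.2
    have ht : (t.1.sort (fun a b : ℕ => a ≤ b)).Nodup := by
      rw [← Multiset.coe_nodup, Multiset.sort_eq]; exact t.2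
    refine (List.perm_ext_iff_of_nodup (hs.filter _) ht).2 fun c => ?_
    simp [List.mem_filter, h]

/-! ### The decidable matrix for runs of a graph machine -/

namespace GraphMachine

variable (M : GraphMachine)

/-- Membership in the vertex set, as a Boolean. -/
def gb (w : ℕ) : Bool := decide (w ∈ M.graph.G)

/-- Elements of `E w v`. -/
def el (w v : ℕ) : List ℕ := lst (Encodable.encode (M.graph.E w v))

/-- Elements of the allowable colors at `v`. -/
def gl (v : ℕ) : List ℕ := lst (Encodable.encode (M.graph.gam (M.graph.V v)))

/-- Pulses received by `v`, based on a finite list of encoded vertex data. -/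
def pul (v : ℕ) (l : List ℕ) : List ℕ :=
  (M.gl v).filter fun c => (List.range l.length).any fun w =>
    M.gb w && (decide (c ∈ M.el w v) && decide (c ∈ lst (l.getD w 0).unpair.1))

/-- A vertex `w` with data `y` contradicts the list `l`. -/
def bad (v : ℕ) (l : List ℕ) (w y : ℕ) : Bool :=
  (decide (w < l.length) && !decide (l.getD w 0 = y)) ||
  (M.gb w && (M.gl v).any fun c =>
    decide (c ∈ M.el w v) && (decide (c ∈ lst y.unpair.1) && !decide (c ∈ M.pul v l)))

/-- Encoded lookup table. -/
def tc (q : ℕ × ℕ × ℕ × ℕ) : ℕ :=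
  Encodable.encode
    (M.T q.1 ((Encodable.decode (α := Finset ℕ) q.2.1).getD ∅) q.2.2.1 q.2.2.2)

/-- Next encoded data at `v`, computed from the list. -/
def nxt (v : ℕ) (l : List ℕ) : ℕ :=
  M.tc (M.graph.V v, Encodable.encode (M.pul v l),
    (l.getD v 0).unpair.2.unpair.1, (l.getD v 0).unpair.2.unpair.2)

/-- Matrix at level one: comparison with the starting configuration. -/
def mat1 (x v z : ℕ) : Bool :=
  !decide (Nat.pair (Encodable.encode (∅ : Finset ℕ)) (Nat.pair ((lst x).getD v 0) M.s) + 1 = z)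

/-- Matrix at odd levels above one. -/
def mat3 (v z w1 : ℕ) (l : List ℕ) : Bool :=
  decide (w1 < l.length) &&
    ((decide (z = 0) && (M.gb w1 && !decide (M.nxt w1 l = l.getD w1 0))) ||
     (!decide (z = 0) && (decide (w1 = v) && !decide (M.nxt w1 l + 1 = z))))

/-- The matrix. -/
def mat (m k w : ℕ) : Bool :=
  cond (decide (m = 1)) (M.mat1 k.unpair.1 k.unpair.2.unpair.1 k.unpair.2.unpair.2)
    (cond m.bodd (M.mat3 k.unpair.2.unpair.1 k.unpair.2.unpair.2 w.unpair.1 (lst w.unpair.2))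
      (!decide (w.unpair.2 = 0) &&
        M.bad k.unpair.2.unpair.1 (lst k.unpair.2.unpair.2) w.unpair.1 w.unpair.2.pred))

section comp

variable {M} {α : Type} [Primcodable α]

theorem gb_comp (hM : M.Computable') {f : α → ℕ} (hf : Computable f) :
    Computable fun a => M.gb (f a) := by
  obtain ⟨inst, h⟩ := hM.1.1
  refine (h.comp hf).of_eq fun a => ?_
  simp [gb]

theorem el_comp (hM : M.Computable') {f g : α → ℕ} (hf : Computable f) (hg : Computable g) :
    Computable fun a => M.el (f a) (g a) :=
  lst_comp (Computable.comp (f := fun p : ℕ × ℕ => Encodable.encode (M.graph.E p.1 p.2))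
    (g := fun a => (f a, g a)) hM.1.2.2.2.2.1 (hf.pair hg))

theorem V_comp (hM : M.Computable') {f : α → ℕ} (hf : Computable f) :
    Computable fun a => M.graph.V (f a) := hM.1.2.2.2.1.comp hf

theorem gl_comp (hM : M.Computable') {f : α → ℕ} (hf : Computable f) :
    Computable fun a => M.gl (f a) :=
  lst_comp (Computable.comp (f := fun l => Encodable.encode (M.graph.gam l))
    (g := fun a => M.graph.V (f a)) hM.1.2.2.2.2.2 (V_comp hM hf))

theorem up1 {f : α → ℕ} (hf : Computable f) : Computable fun a => (f a).unpair.1 :=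
  (Primrec.fst.comp Primrec.unpair).to_comp.comp hf

theorem up2 {f : α → ℕ} (hf : Computable f) : Computable fun a => (f a).unpair.2 :=
  (Primrec.snd.comp Primrec.unpair).to_comp.comp hf

theorem pul_comp (hM : M.Computable') {f : α → ℕ} {l : α → List ℕ} (hf : Computable f)
    (hl : Computable l) : Computable fun a => M.pul (f a) (l a) := by
  refine filter_comp (gl_comp hM hf) ?_
  have h1 : Computable fun p : α × ℕ => List.range (l p.1).length :=
    Primrec.list_range.to_comp.comp (Computable.list_length.comp (hl.comp Computable.fst))
  refine any_comp (α := α × ℕ) h1 ?_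
  have ha : Computable fun p : (α × ℕ) × ℕ => p.1.1 := Computable.fst.comp Computable.fst
  have hc : Computable fun p : (α × ℕ) × ℕ => p.1.2 := Computable.snd.comp Computable.fst
  have hw : Computable fun p : (α × ℕ) × ℕ => p.2 := Computable.snd
  exact and_comp (gb_comp hM hw) (and_comp (mem_comp hc (el_comp hM hw (hf.comp ha)))
    (mem_comp hc (lst_comp (up1 (getD_comp (hl.comp ha) hw)))))

theorem bad_comp (hM : M.Computable') {f g h : α → ℕ} {l : α → List ℕ} (hf : Computable f)
    (hl : Computable l) (hg : Computable g) (hh : Computable h) :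
    Computable fun a => M.bad (f a) (l a) (g a) (h a) := by
  refine or_comp (and_comp (ltb_comp hg (Computable.list_length.comp hl))
    (not_comp (eqb_comp (getD_comp hl hg) hh))) (and_comp (gb_comp hM hg) ?_)
  refine any_comp (gl_comp hM hf) ?_
  have ha : Computable fun p : α × ℕ => p.1 := Computable.fst
  have hc : Computable fun p : α × ℕ => p.2 := Computable.snd
  exact and_comp (mem_comp hc (el_comp hM (hg.comp ha) (hf.comp ha)))
    (and_comp (mem_comp hc (lst_comp (up1 (hh.comp ha))))
      (not_comp (mem_comp hc (pul_comp hM (hf.comp ha) (hl.comp ha)))))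

theorem nxt_comp (hM : M.Computable') {f : α → ℕ} {l : α → List ℕ} (hf : Computable f)
    (hl : Computable l) : Computable fun a => M.nxt (f a) (l a) := by
  have hT : Computable M.tc := hM.2.2.2
  refine hT.comp ((V_comp hM hf).pair ((Computable.encode.comp (pul_comp hM hf hl)).pair
    ((up1 (up2 (getD_comp hl hf))).pair (up2 (up2 (getD_comp hl hf))))))

theorem mat_comp (hM : M.Computable') :
    Computable fun p : ℕ × ℕ × ℕ => M.mat p.1 p.2.1 p.2.2 := by
  have hm : Computable fun p : ℕ × ℕ × ℕ => p.1 := Computable.fst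
  have hk : Computable fun p : ℕ × ℕ × ℕ => p.2.1 := Computable.fst.comp Computable.snd
  have hw : Computable fun p : ℕ × ℕ × ℕ => p.2.2 := Computable.snd.comp Computable.snd
  have hx := up1 hk
  have hv := up1 (up2 hk)
  have hz := up2 (up2 hk)
  have hw1 := up1 hw
  have hw2 := up2 hw
  have hl := lst_comp hw2
  have pr : ∀ {f g : ℕ × ℕ × ℕ → ℕ}, Computable f → Computable g →
      Computable fun a => Nat.pair (f a) (g a) := fun hf hg =>
    Primrec₂.natPair.to_comp.comp hf hg
  have sc : ∀ {f : ℕ × ℕ × ℕ → ℕ}, Computable f →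
      Computable fun a => f a + 1 := fun hf => Computable.succ.comp hf
  have h0 := eqb_comp hz (Computable.const 0)
  refine Computable.cond (eqb_comp hm (Computable.const 1)) ?_
    (Computable.cond (Computable.nat_bodd.comp hm) ?_ ?_)
  · exact not_comp (eqb_comp (sc (pr (Computable.const _)
      (pr (getD_comp (lst_comp hx) hv) (Computable.const _)))) hz)
  · exact and_comp (ltb_comp hw1 (Computable.list_length.comp hl))
      (or_comp (and_comp h0 (and_comp (gb_comp hM hw1)
          (not_comp (eqb_comp (nxt_comp hM hw1 hl) (getD_comp hl hw1)))))
        (and_comp (not_comp h0) (and_comp (eqb_comp hw1 hv)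
          (not_comp (eqb_comp (sc (nxt_comp hM hw1 hl)) hz)))))
  · exact and_comp (not_comp (eqb_comp hw2 (Computable.const 0)))
      (bad_comp hM hv (lst_comp hz) hw1 (Computable.pred.comp hw2))

end comp

/-! ### Semantics -/

/-- The encoded run from the starting configuration coded by `x`. -/
def er (x n v : ℕ) : ℕ := Encodable.encode (M.run (M.start (decodeFS x)) n v)

theorem er_eq (x n v : ℕ) : M.er x n v =
    Nat.pair (Encodable.encode (M.run (M.start (decodeFS x)) n v).1)
      (Nat.pair (M.run (M.start (decodeFS x)) n v).2.1
        (M.run (M.start (decodeFS x)) n v).2.2) := rfl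

theorem er_fst (x n v : ℕ) : (M.er x n v).unpair.1 =
    Encodable.encode (M.run (M.start (decodeFS x)) n v).1 := by
  rw [er_eq]; simp only [Nat.unpair_pair]

theorem er_z (x n v : ℕ) : (M.er x n v).unpair.2.unpair.1 =
    (M.run (M.start (decodeFS x)) n v).2.1 := by
  rw [er_eq]; simp only [Nat.unpair_pair]

theorem er_t (x n v : ℕ) : (M.er x n v).unpair.2.unpair.2 =
    (M.run (M.start (decodeFS x)) n v).2.2 := by
  rw [er_eq]; simp only [Nat.unpair_pair]

/-- A list is good for `v` at stage `n`. -/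
def Good (x n v : ℕ) (l : List ℕ) : Prop := ∀ w, M.bad v l w (M.er x n w) = false

theorem mem_pulses (g : Config) (v c : ℕ) : c ∈ M.pulses g v ↔ c ∈ M.gl v ∧
    ∃ w ∈ M.graph.G, c ∈ M.graph.E w v ∧ c ∈ (g w).1 := by
  simp [pulses, gl, mem_lst_finset]

variable {M}

theorem Good.get {x n v : ℕ} {l : List ℕ} (h : M.Good x n v l) {w : ℕ} (hw : w < l.length) :
    l.getD w 0 = M.er x n w := by
  have := h w
  simp only [bad, Bool.or_eq_false_iff] at this
  simpa [hw] using this.1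

theorem Good.pul {x n v : ℕ} {l : List ℕ} (h : M.Good x n v l) :
    Encodable.encode (M.pul v l) =
      Encodable.encode (M.pulses (M.run (M.start (decodeFS x)) n) v) := by
  refine encode_filter _ _ _ fun c => ?_
  rw [mem_pulses, gl, mem_lst_finset]
  refine and_congr_right fun hc => ?_
  have hc' : c ∈ M.gl v := by rw [gl, mem_lst_finset]; exact hc
  constructor
  · rintro ⟨w, hw, hE, hr⟩
    by_contra hn
    have hnp : c ∉ M.pul v l := by
      intro hp
      exact hn (List.mem_filter.1 hp).2
    have hb := h w
    simp only [bad, Bool.or_eq_false_iff] at hb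
    have h2 := hb.2
    rw [Bool.eq_false_iff] at h2
    apply h2
    rw [Bool.and_eq_true]
    refine ⟨by simpa [gb] using hw, List.any_eq_true.2 ⟨c, hc', ?_⟩⟩
    simp only [er_fst, el, mem_lst_finset, Bool.and_eq_true, decide_eq_true_eq,
      Bool.not_eq_true', decide_eq_false_iff_not]
    exact ⟨hE, hr, hnp⟩
  · intro hp
    obtain ⟨w, hw, hq⟩ := List.any_eq_true.1 hp
    have hw := List.mem_range.1 hw
    rw [h.get hw] at hq
    simp only [gb, er_fst, el, mem_lst_finset, Bool.and_eq_true, decide_eq_true_eq] at hq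
    exact ⟨w, hq⟩

theorem Good.nxt {x n v : ℕ} {l : List ℕ} (h : M.Good x n v l) (hv : v < l.length) :
    M.nxt v l = M.er x (n + 1) v := by
  rw [GraphMachine.nxt, h.pul, h.get hv, er_z, er_t, tc]
  simp only [Encodable.encodek, Option.getD_some]
  rfl

theorem exists_good (x n v : ℕ) : ∃ l, v < l.length ∧ M.Good x n v l := by
  have hw : ∀ c, ∃ w, c ∈ M.pulses (M.run (M.start (decodeFS x)) n) v →
      w ∈ M.graph.G ∧ c ∈ M.graph.E w v ∧ c ∈ (M.run (M.start (decodeFS x)) n w).1 := by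
    intro c
    by_cases hc : c ∈ M.pulses (M.run (M.start (decodeFS x)) n) v
    · obtain ⟨w, hw⟩ := ((M.mem_pulses _ _ _).1 hc).2
      exact ⟨w, fun _ => hw⟩
    · exact ⟨0, fun h => absurd h hc⟩
  choose wit hwit using hw
  let N := (M.pulses (M.run (M.start (decodeFS x)) n) v).sup wit + v + 1
  let l := (List.range N).map (M.er x n)
  have hlen : l.length = N := by simp [l]
  have hget : ∀ w, w < N → l.getD w 0 = M.er x n w := by
    intro w hw
    rw [List.getD_eq_getElem _ _ (by rw [hlen]; exact hw)]
    simp [l]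
  refine ⟨l, by rw [hlen]; omega, fun w => ?_⟩
  simp only [bad, Bool.or_eq_false_iff]
  constructor
  · by_cases h : w < l.length
    · rw [hlen] at h; rw [hget w h]; simp
    · simp [h]
  · rw [Bool.eq_false_iff]
    intro hb
    rw [Bool.and_eq_true, List.any_eq_true] at hb
    obtain ⟨hG, c, hc, hq⟩ := hb
    simp only [er_fst, el, mem_lst_finset, Bool.and_eq_true, decide_eq_true_eq,
      Bool.not_eq_true', decide_eq_false_iff_not] at hq
    have hp : c ∈ M.pulses (M.run (M.start (decodeFS x)) n) v :=
      (M.mem_pulses _ _ _).2 ⟨hc, w, by simpa [gb] using hG, hq.1, hq.2.1⟩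
    apply hq.2.2
    refine List.mem_filter.2 ⟨hc, List.any_eq_true.2 ⟨wit c, ?_, ?_⟩⟩
    · rw [hlen, List.mem_range]
      have := Finset.le_sup (f := wit) hp
      omega
    · have hlt : wit c < N := by
        have := Finset.le_sup (f := wit) hp
        omega
      rw [hget _ hlt]
      simp only [gb, er_fst, el, mem_lst_finset, Bool.and_eq_true, decide_eq_true_eq]
      exact hwit c hp

/-- The hierarchy at `⟨x, ⟨v, z⟩⟩`. -/
def hq (M : GraphMachine) (m x v z : ℕ) : Prop :=
  hierQ M.mat m (Nat.pair x (Nat.pair v z))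

theorem hq_one (x v z : ℕ) : M.hq 1 x v z ↔ M.er x 0 v + 1 ≠ z := by
  simp only [hq, hierQ, mat, mat1, Nat.unpair_pair]
  have : M.er x 0 v = Nat.pair (Encodable.encode (∅ : Finset ℕ))
      (Nat.pair ((lst x).getD v 0) M.s) := rfl
  simp [this]

theorem hq_even (n x v z : ℕ) : M.hq (2 * n + 2) x v z ↔
    ∃ w y, M.bad v (lst z) w y = true ∧ ¬ M.hq (2 * n + 1) x w (y + 1) := by
  have hb : (2 * n + 2).bodd = false := by simp [Nat.bodd_mul]
  have h1 : 2 * n + 1 + 1 ≠ 1 := by omega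
  have e : 2 * n + 1 + 1 = 2 * n + 2 := rfl
  simp only [hq]
  rw [← e, hierQ]
  simp only [mat, Nat.unpair_pair, h1, decide_false, cond_false]
  rw [e, hb]
  constructor
  · rintro ⟨w, hw, hn⟩
    simp only [cond_false, Bool.and_eq_true, Bool.not_eq_true', decide_eq_false_iff_not] at hw
    have h2 : w.unpair.2.pred + 1 = w.unpair.2 := Nat.succ_pred hw.1
    exact ⟨w.unpair.1, w.unpair.2.pred, hw.2, by rw [h2, Nat.pair_unpair]; exact hn⟩
  · rintro ⟨w, y, hw, hn⟩
    exact ⟨Nat.pair w (y + 1), by simpa using hw, hn⟩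

theorem hq_odd (n x v z : ℕ) : M.hq (2 * n + 3) x v z ↔
    ∃ w y, M.mat3 v z w (lst y) = true ∧ ¬ M.hq (2 * n + 2) x w y := by
  have hb : (2 * n + 3).bodd = true := by simp [Nat.bodd_mul]
  have h1 : 2 * n + 2 + 1 ≠ 1 := by omega
  have e : 2 * n + 2 + 1 = 2 * n + 3 := rfl
  simp only [hq]
  rw [← e, hierQ]
  simp only [mat, Nat.unpair_pair, h1, decide_false, cond_false]
  rw [e, hb]
  constructor
  · rintro ⟨w, hw, hn⟩
    exact ⟨w.unpair.1, w.unpair.2, hw, by rw [Nat.pair_unpair]; exact hn⟩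
  · rintro ⟨w, y, hw, hn⟩
    exact ⟨Nat.pair w y, by simpa using hw, hn⟩

theorem hq_run (x n : ℕ) : ∀ v y, M.hq (2 * n + 1) x v (y + 1) ↔ M.er x n v ≠ y := by
  induction n with
  | zero => intro v y; simp [hq_one]
  | succ n ih =>
    intro v y
    have e : 2 * (n + 1) + 1 = 2 * n + 3 := by ring
    rw [e, hq_odd]
    have hgood : ∀ w z, ¬ M.hq (2 * n + 2) x w z ↔ M.Good x n w (lst z) := by
      intro w z
      rw [hq_even]
      simp only [ih, not_exists, not_and, not_not, Good]
      constructor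
      · intro h w'
        rw [Bool.eq_false_iff]
        exact fun hb => h w' _ hb rfl
      · intro h w' y' hb he
        rw [← he, h w'] at hb
        exact Bool.false_ne_true hb
    simp only [hgood]
    constructor
    · rintro ⟨w, z, hm, hg⟩
      simp only [mat3, Bool.and_eq_true, Bool.or_eq_true, decide_eq_true_eq,
        Bool.not_eq_true', decide_eq_false_iff_not] at hm
      obtain ⟨hlt, hm⟩ := hm
      rcases hm with hm | hm
      · omega
      · obtain ⟨-, rfl, hne⟩ := hm
        rw [hg.nxt hlt] at hne
        omega
    · intro hne
      obtain ⟨l, hv, hg⟩ := M.exists_good x n v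
      refine ⟨v, Encodable.encode l, ?_, by rw [lst_encode]; exact hg⟩
      rw [lst_encode]
      simp only [mat3, Bool.and_eq_true, Bool.or_eq_true, decide_eq_true_eq,
        Bool.not_eq_true', decide_eq_false_iff_not]
      refine ⟨hv, Or.inr ⟨by omega, trivial, ?_⟩⟩
      rw [hg.nxt hv]
      omega

theorem hq_good (x n w z : ℕ) : ¬ M.hq (2 * n + 2) x w z ↔ M.Good x n w (lst z) := by
  rw [hq_even]
  simp only [hq_run, not_exists, not_and, not_not, Good]
  constructor
  · intro h w'
    rw [Bool.eq_false_iff]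
    exact fun hb => h w' _ hb rfl
  · intro h w' y' hb he
    rw [← he, h w'] at hb
    exact Bool.false_ne_true hb

theorem hq_halt (x n v : ℕ) :
    ¬ M.hq (2 * n + 3) x v 0 ↔ M.HaltsAt (M.start (decodeFS x)) n := by
  rw [hq_odd]
  simp only [hq_good]
  have hinj : ∀ w, M.er x (n + 1) w = M.er x n w ↔
      M.run (M.start (decodeFS x)) (n + 1) w = M.run (M.start (decodeFS x)) n w :=
    fun w => Encodable.encode_injective.eq_iff
  constructor
  · intro h w hw
    by_contra hne
    apply h
    obtain ⟨l, hv, hg⟩ := M.exists_good x n w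
    refine ⟨w, Encodable.encode l, ?_, by rw [lst_encode]; exact hg⟩
    rw [lst_encode]
    simp only [mat3, Bool.and_eq_true, Bool.or_eq_true, decide_eq_true_eq,
      Bool.not_eq_true', decide_eq_false_iff_not]
    refine ⟨hv, Or.inl ⟨trivial, by simpa [gb] using hw, ?_⟩⟩
    rw [hg.nxt hv, hg.get hv, hinj]
    exact hne
  · rintro h ⟨w, z, hm, hg⟩
    simp only [mat3, Bool.and_eq_true, Bool.or_eq_true, decide_eq_true_eq,
      Bool.not_eq_true', decide_eq_false_iff_not] at hm
    obtain ⟨hlt, hm⟩ := hm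
    rcases hm with hm | hm
    · have hG : w ∈ M.graph.G := by simpa [gb] using hm.2.1
      apply hm.2.2
      rw [hg.nxt hlt, hg.get hlt, hinj]
      exact h w hG
    · exact hm.1 trivial

/-- Once halted, always halted. -/
theorem HaltsAt.le {f : Config} {n : ℕ} (h : M.HaltsAt f n) :
    ∀ m, n ≤ m → ∀ v ∈ M.graph.G, M.run f m v = M.run f n v := by
  intro m hm
  induction m, hm using Nat.le_induction with
  | base => intro v _; rfl
  | succ m _ ih =>
    intro v hv
    rw [← h v hv]
    have hp : M.pulses (M.run f m) v = M.pulses (M.run f n) v := by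
      ext c
      rw [mem_pulses, mem_pulses]
      refine and_congr_right fun _ => exists_congr fun w => and_congr_right fun hw => ?_
      rw [ih w hw]
    show M.T _ (M.pulses (M.run f m) v) (M.run f m v).2.1 (M.run f m v).2.2 =
      M.T _ (M.pulses (M.run f n) v) (M.run f n v).2.1 (M.run f n v).2.2
    rw [hp, ih v hv]

theorem outputAt_eq {x : ℕ → ℕ} {n v : ℕ} (h : M.HaltsAt (M.start x) n)
    (hv : v ∈ M.graph.G) : M.outputAt x v = (M.run (M.start x) n v).2.1 := by
  have hne : {n | M.HaltsAt (M.start x) n}.Nonempty := ⟨n, h⟩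
  have h0 : M.HaltsAt (M.start x) (sInf {n | M.HaltsAt (M.start x) n}) := Nat.sInf_mem hne
  rw [outputAt, HaltsAt.le h0 n (Nat.sInf_le h) v hv]

/-- Decision procedure for legal inputs. -/
def okb (M : GraphMachine) (p : ℕ) : Bool :=
  M.gb p.unpair.2 && !(List.range (lst p.unpair.1).length).any fun v =>
    (M.gb v && !decide ((lst p.unpair.1).getD v 0 ∈ M.A.toList)) ||
      (!M.gb v && !decide ((lst p.unpair.1).getD v 0 = 0))

theorem okb_comp (hM : M.Computable') : Computable M.okb := by
  have hi : Computable fun p : ℕ => p := Computable.id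
  refine and_comp (gb_comp hM (up2 hi)) (not_comp (any_comp ?_ ?_))
  · exact Primrec.list_range.to_comp.comp (Computable.list_length.comp (lst_comp (up1 hi)))
  · have hp : Computable fun p : ℕ × ℕ => p.1 := Computable.fst
    have hv : Computable fun p : ℕ × ℕ => p.2 := Computable.snd
    have hg := getD_comp (lst_comp (up1 hp)) hv
    exact or_comp (and_comp (gb_comp hM hv) (not_comp (mem_comp hg (Computable.const _))))
      (and_comp (not_comp (gb_comp hM hv)) (not_comp (eqb_comp hg (Computable.const 0))))

theorem okb_iff (p : ℕ) : M.okb p = true ↔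
    p.unpair.2 ∈ M.graph.G ∧ M.InDom (decodeFS p.unpair.1) := by
  have hd : ∀ v, decodeFS p.unpair.1 v = (lst p.unpair.1).getD v 0 := fun _ => rfl
  have hz : ∀ v, ¬ v < (lst p.unpair.1).length → (lst p.unpair.1).getD v 0 = 0 := by
    intro v hv
    exact List.getD_eq_default _ _ (by omega)
  have hfin : {v | decodeFS p.unpair.1 v ≠ 0}.Finite := by
    refine (Set.finite_lt_nat (lst p.unpair.1).length).subset fun v hv => ?_
    by_contra hn
    exact hv (hz v hn)
  simp only [okb, Bool.and_eq_true, Bool.not_eq_true', InDom, hd] at hfin ⊢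
  rw [List.any_eq_false]
  simp only [List.mem_range, Bool.or_eq_true, Bool.and_eq_true, gb, decide_eq_true_eq,
    Bool.not_eq_true', decide_eq_false_iff_not, Finset.mem_toList]
  refine and_congr_right fun _ => ⟨fun h => ⟨fun v hv => ?_, fun v hv => ?_, hfin⟩, ?_⟩
  · by_cases hl : v < (lst p.unpair.1).length
    · have := h v hl; tauto
    · rw [hz v hl]; exact M.zero_mem
  · by_cases hl : v < (lst p.unpair.1).length
    · have := h v hl; tauto
    · exact hz v hl
  · rintro ⟨h1, h2, -⟩ v _ hq
    rcases hq with hq | hq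
    · exact hq.2 (h1 v hq.1)
    · exact hq.2 (h2 v hq.1)

end GraphMachine

/-- If `{M} : 𝔄^{<G} → 𝔄^G` is total for a computable graph machine
`M`, then `{M}` is computable from `𝟎^(ω)`. -/
theorem stmt6 (M : GraphMachine) (hM : M.Computable') (hT : M.Total) :
    TuringLE M.fn zeroOmega := by
  obtain ⟨q, hq, hqs⟩ := hier_index M.mat (GraphMachine.mat_comp hM)
  -- search input `⟨p, ⟨n, y⟩⟩` with `p = ⟨x, v⟩`
  let p : ℕ → ℕ := fun i => i.unpair.1
  let x : ℕ → ℕ := fun i => i.unpair.1.unpair.1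
  let v : ℕ → ℕ := fun i => i.unpair.1.unpair.2
  let n : ℕ → ℕ := fun i => i.unpair.2.unpair.1
  let y : ℕ → ℕ := fun i => i.unpair.2.unpair.2
  have hi : Computable fun i : ℕ => i := Computable.id
  have hp : Computable p := GraphMachine.up1 hi
  have hx : Computable x := GraphMachine.up1 hp
  have hv : Computable v := GraphMachine.up2 hp
  have hn : Computable n := GraphMachine.up1 (GraphMachine.up2 hi)
  have hy : Computable y := GraphMachine.up2 (GraphMachine.up2 hi)
  have pr : ∀ {f g : ℕ → ℕ}, Computable f → Computable g →
      Computable fun a => Nat.pair (f a) (g a) := fun hf hg =>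
    Primrec₂.natPair.to_comp.comp hf hg
  have ad : ∀ (k : ℕ), Computable fun i => 2 * n i + k := fun k =>
    Primrec.nat_add.to_comp.comp (Primrec.nat_mul.to_comp.comp (Computable.const 2) hn)
      (Computable.const k)
  let u1 : ℕ → ℕ := fun i => Nat.pair (2 * n i + 3)
    (q (2 * n i + 3) (Nat.pair (x i) (Nat.pair (v i) 0)))
  let u2 : ℕ → ℕ := fun i => Nat.pair (2 * n i + 1)
    (q (2 * n i + 1) (Nat.pair (x i) (Nat.pair (v i) (y i + 1))))
  have hu1 : Computable u1 := pr (ad 3) (hq.comp (ad 3) (pr hx (pr hv (Computable.const 0))))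
  have hu2 : Computable u2 :=
    pr (ad 1) (hq.comp (ad 1) (pr hx (pr hv (Computable.succ.comp hy))))
  have hok : Computable fun i => cond (M.okb (p i)) 1 0 :=
    Computable.cond ((GraphMachine.okb_comp hM).comp hp) (Computable.const 1) (Computable.const 0)
  have hadd : UnifC fun _ i => i.unpair.1 + i.unpair.2 :=
    .of_computable (Primrec.nat_add.to_comp.comp (GraphMachine.up1 hi) (GraphMachine.up2 hi))
  have hmul : UnifC fun _ i => i.unpair.1 * i.unpair.2 :=
    .of_computable (Primrec.nat_mul.to_comp.comp (GraphMachine.up1 hi) (GraphMachine.up2 hi))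
  have hF : UnifC fun O i => cond (M.okb (p i)) 1 0 * (O (u1 i) + O (u2 i)) := by
    have := hmul.comp ((UnifC.of_computable hok).pair (hadd.comp
      ((UnifC.oracle.comp (UnifC.of_computable hu1)).pair
        (UnifC.oracle.comp (UnifC.of_computable hu2)))))
    simpa using this
  obtain ⟨c, hc⟩ := hF.search
  -- final extraction: input `⟨p, ⟨n, y⟩⟩`
  have hout : Computable fun i => cond (M.okb (p i)) (y i).unpair.2.unpair.1 0 :=
    Computable.cond ((GraphMachine.okb_comp hM).comp hp)
      (GraphMachine.up1 (GraphMachine.up2 hy)) (Computable.const 0)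
  obtain ⟨d, hd⟩ := UnifC.of_computable hout
  obtain ⟨ci, hci⟩ := UnifC.of_computable hi
  refine ⟨.comp d (.pair ci c), fun a => ?_⟩
  have hO : ∀ m k, zeroOmega (Nat.pair m (q m k)) = if hierQ M.mat m k then 1 else 0 := by
    intro m k
    rw [← hqs]
    simp [zeroOmega, omegaIter, zeroN]
  have hz : ∀ w, M.okb a = true → (cond (M.okb (p (Nat.pair a w))) 1 0 *
      (zeroOmega (u1 (Nat.pair a w)) + zeroOmega (u2 (Nat.pair a w))) = 0 ↔
      M.HaltsAt (M.start (decodeFS a.unpair.1)) w.unpair.1 ∧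
        M.er a.unpair.1 w.unpair.1 a.unpair.2 = w.unpair.2) := by
    intro w ha
    have h1 := GraphMachine.hq_halt (M := M) a.unpair.1 w.unpair.1 a.unpair.2
    have h2 := GraphMachine.hq_run (M := M) a.unpair.1 w.unpair.1 a.unpair.2 w.unpair.2
    rw [← h1, ← not_not (a := M.er _ _ _ = _), ← ne_eq, ← h2]
    simp only [u1, u2, p, n, x, v, y, Nat.unpair_pair, ha, hO, GraphMachine.hq]
    simp
  have hdom : (c.eval zeroOmega a).Dom := by
    refine (hc _ _).1.2 ?_
    by_cases ha : M.okb a = true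
    · obtain ⟨k, hk⟩ := hT _ ((M.okb_iff a).1 ha).2
      refine ⟨Nat.pair k (M.er a.unpair.1 k a.unpair.2), (hz _ ha).2 ?_⟩
      simp only [Nat.unpair_pair]
      exact ⟨hk, trivial⟩
    · refine ⟨0, ?_⟩
      simp [p, ha]
  obtain ⟨w, hw⟩ := Part.dom_iff_mem.1 hdom
  have hcw : c.eval zeroOmega a = Part.some w := Part.eq_some_iff.2 hw
  have hspec := (hc zeroOmega a).2 w hw
  have hpair : (OCode.pair ci c).eval zeroOmega a = Part.some (Nat.pair a w) := by
    simp [OCode.eval, hci, hcw, Seq.seq]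
  have hcomp : (OCode.comp d (OCode.pair ci c)).eval zeroOmega a =
      d.eval zeroOmega (Nat.pair a w) := by
    show (OCode.pair ci c).eval zeroOmega a >>= d.eval zeroOmega = _
    rw [hpair]
    exact Part.bind_some _ _
  rw [hcomp, hd]
  congr 1
  simp only [p, y, Nat.unpair_pair]
  by_cases ha : M.okb a = true
  · obtain ⟨hh, he⟩ := (hz w ha).1 hspec
    obtain ⟨hG, hD⟩ := (M.okb_iff a).1 ha
    rw [ha, cond_true, GraphMachine.fn, if_pos ⟨hD, ⟨_, hh⟩, hG⟩, ← he, GraphMachine.er_z,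
      GraphMachine.outputAt_eq hh hG]
  · have hne : ¬ (M.InDom (decodeFS a.unpair.1) ∧ M.Halts (M.start (decodeFS a.unpair.1)) ∧
        a.unpair.2 ∈ M.graph.G) := fun h => ha ((M.okb_iff a).2 ⟨h.2.2, h.1⟩)
    rw [GraphMachine.fn, if_neg hne, Bool.eq_false_iff.2 ha, cond_false]

end
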